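/- In the merged traveling-wave configuration, let x(τ) denote the unique intersection point with u₁(x(τ),τ) = u₂(x(τ),τ) and set d = (γ_λ γ_{λ'} + (p − 1))/p. Then there exists a constant K > 0 such that lim_{τ→−∞} e^{−dτ} (1 − v_λ(x(τ) − λτ + h)) = K, lim_{τ→−∞} e^{−dτ} v_λ'(x(τ) − λτ + h) = γ_λ K, and lim_{τ→−∞} e^{−dτ} v_{λ'}'(−x(τ) − λ'τ + h') = γ_{λ'} K. -/

import Mathlib

open Real Filter Topology MeasureTheory

/-- A traveling-wave profile with speed `lam` for the cylindrical Yamabe-flow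
equation `(u^p)_τ = u_{xx} + u^p - u`: it is `C²`, takes values in `(0,1]`,
is strictly increasing, solves `v'' + λ p v^{p-1} v' + v^p - v = 0`,
tends to `0` at `-∞` and to `1` at `+∞`. -/
def IsTWProfile (p lam : ℝ) (v : ℝ → ℝ) : Prop :=
  ContDiff ℝ 2 v ∧ (∀ x, 0 < v x) ∧ (∀ x, v x ≤ 1) ∧ (∀ x, 0 < deriv v x) ∧
  (∀ x, deriv (deriv v) x + lam * p * v x ^ (p - 1) * deriv v x + v x ^ p - v x = 0) ∧
  Filter.Tendsto v Filter.atBot (nhds 0) ∧ Filter.Tendsto v Filter.atTop (nhds 1)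

/-- The profile `v` has exponential asymptotics at `+∞` with rate `gam` and
constant `C`: `v(x) = 1 - C e^{-γ x} + o(e^{-γ x})` where `γ` is a root of the
characteristic equation `γ² - λ p γ + (p-1) = 0`. -/
def HasExpAsym (p lam gam C : ℝ) (v : ℝ → ℝ) : Prop :=
  0 < gam ∧ 0 < C ∧ gam ^ 2 - lam * p * gam + (p - 1) = 0 ∧
  Filter.Tendsto (fun x => Real.exp (gam * x) * (1 - v x)) Filter.atTop (nhds C)

lemma tw_lt_one {p lam : ℝ} {v : ℝ → ℝ} (hv : IsTWProfile p lam v) :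
    StrictMono v ∧ ∀ x, v x < 1 := by
  obtain ⟨hc, hpos, hle, hd, hode, hb, ht⟩ := hv
  have hm : StrictMono v := strictMono_of_deriv_pos hd
  exact ⟨hm, fun x => (hm (lt_add_one x)).trans_le (hle _)⟩

lemma tw_slope {p lam : ℝ} {v : ℝ → ℝ} (hv : IsTWProfile p lam v) :
    Tendsto (fun x => (1 - v x ^ p) / (1 - v x)) atTop (𝓝 p) := by
  obtain ⟨hm, hlt⟩ := tw_lt_one hv
  obtain ⟨hc, hpos, hle, hd, hode, hb, ht⟩ := hv
  have h1 : HasDerivAt (fun y : ℝ => y ^ p) p 1 := by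
    simpa using Real.hasDerivAt_rpow_const (x := 1) (p := p) (Or.inl one_ne_zero)
  have h2 := h1.tendsto_slope
  have h3 : Tendsto v atTop (𝓝[≠] 1) :=
    tendsto_nhdsWithin_iff.2 ⟨ht, Eventually.of_forall fun x => (hlt x).ne⟩
  refine (h2.comp h3).congr fun x => ?_
  have : 1 - v x ≠ 0 := (sub_pos.2 (hlt x)).ne'
  have : v x - 1 ≠ 0 := (sub_neg.2 (hlt x)).ne
  simp only [Function.comp, slope_def_field, Real.one_rpow]
  rw [div_eq_div_iff] <;> first | assumption | ring

lemma tw_hasDeriv {p lam : ℝ} {v : ℝ → ℝ} (hv : IsTWProfile p lam v) (x : ℝ) :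
    HasDerivAt (fun x => deriv v x + lam * v x ^ p) (v x - v x ^ p) x := by
  obtain ⟨hc, hpos, hle, hd, hode, hb, ht⟩ := hv
  have hc1 : ContDiff ℝ 1 (deriv v) := by
    have : ContDiff ℝ (1 + 1) v := by simpa [one_add_one_eq_two] using hc
    exact (contDiff_succ_iff_deriv.1 this).2.2
  have h1 : HasDerivAt (deriv v) (deriv (deriv v) x) x :=
    (hc1.differentiable (by norm_num) x).hasDerivAt
  have h0 : HasDerivAt v (deriv v x) x := (hc.differentiable (by norm_num) x).hasDerivAt
  have h2 := h1.add ((h0.rpow_const (p := p) (Or.inl (hpos x).ne')).const_mul lam)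
  refine h2.congr_deriv ?_
  have := hode x
  linarith

lemma tw_deriv_zero {p lam : ℝ} {v : ℝ → ℝ} (hp : 1 < p) (hv : IsTWProfile p lam v) :
    Tendsto (deriv v) atTop (𝓝 0) := by
  have hg := tw_hasDeriv hv
  obtain ⟨hm, hlt⟩ := tw_lt_one hv
  obtain ⟨hc, hpos, hle, hd, hode, hb, ht⟩ := hv
  have hmono : Monotone (fun x => deriv v x + lam * v x ^ p) := by
    refine monotone_of_deriv_nonneg (fun x => (hg x).differentiableAt) fun x => ?_
    rw [(hg x).deriv, sub_nonneg]
    exact Real.rpow_le_self_of_le_one (hpos x).le (hle x) hp.le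
  have hdiff : Differentiable ℝ v := hc.differentiable (by norm_num)
  have hex : ∀ x : ℝ, ∃ y, x < y ∧ deriv v y = v (x + 1) - v x := by
    intro x
    obtain ⟨y, hy, h⟩ := exists_deriv_eq_slope v (lt_add_one x) hdiff.continuous.continuousOn
      hdiff.differentiableOn
    exact ⟨y, hy.1, by simpa using h⟩
  choose ξ hξ hξd using hex
  have hξt : Tendsto ξ atTop atTop := tendsto_atTop_mono (fun x => (hξ x).le) tendsto_id
  have hz : Tendsto (fun x => deriv v (ξ x)) atTop (𝓝 0) := by
    have h1 : Tendsto (fun x => v (x + 1) - v x) atTop (𝓝 (1 - 1)) :=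
      (ht.comp (tendsto_atTop_add_const_right _ 1 tendsto_id)).sub ht
    rw [sub_self] at h1
    exact h1.congr fun x => (hξd x).symm
  have hpow : Tendsto (fun x => lam * v x ^ p) atTop (𝓝 lam) := by
    have := (ht.rpow_const (p := p) (Or.inl one_ne_zero)).const_mul lam
    simpa using this
  have hgξ : Tendsto (fun x => deriv v (ξ x) + lam * v (ξ x) ^ p) atTop (𝓝 (0 + lam)) :=
    hz.add (hpow.comp hξt)
  rcases tendsto_atTop_of_monotone hmono with h | ⟨l, h⟩
  · exact absurd hgξ (not_tendsto_nhds_of_tendsto_atTop (h.comp hξt) _)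
  · have hl : l = 0 + lam := tendsto_nhds_unique (h.comp hξt) hgξ
    have := h.sub hpow
    rw [hl] at this
    simpa using this

lemma tw_deriv_asym {p lam gam C : ℝ} {v : ℝ → ℝ} (hp : 1 < p) (hv : IsTWProfile p lam v)
    (ha : HasExpAsym p lam gam C v) :
    Tendsto (fun x => deriv v x / (1 - v x)) atTop (𝓝 gam) := by
  have hg := tw_hasDeriv hv
  have hs := tw_slope hv
  have h0 := tw_deriv_zero hp hv
  obtain ⟨hm, hlt⟩ := tw_lt_one hv
  obtain ⟨hc, hpos, hle, hd, hode, hb, ht⟩ := hv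
  obtain ⟨hgam, hC, hchar, hlim⟩ := ha
  have hw : ∀ x, 1 - v x ≠ 0 := fun x => (sub_pos.2 (hlt x)).ne'
  have hpow : Tendsto (fun x => lam * v x ^ p) atTop (𝓝 lam) := by
    have := (ht.rpow_const (p := p) (Or.inl one_ne_zero)).const_mul lam
    simpa using this
  have key : Tendsto (fun x => (lam - (deriv v x + lam * v x ^ p)) / Real.exp (-(gam * x)))
      atTop (𝓝 ((p - 1) * C / gam)) := by
    have hlin : Tendsto (fun x : ℝ => -(gam * x)) atTop atBot :=
      tendsto_neg_atTop_atBot.comp (tendsto_id.const_mul_atTop hgam)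
    refine HasDerivAt.lhopital_zero_atTop (f' := fun x => -(v x - v x ^ p))
      (g' := fun x => Real.exp (-(gam * x)) * (-gam)) ?_ ?_ ?_ ?_ ?_ ?_
    · exact Eventually.of_forall fun x => (hg x).const_sub lam
    · refine Eventually.of_forall fun x => ?_
      have h1 : HasDerivAt (fun x : ℝ => -(gam * x)) (-gam) x := by
        have h2 := (hasDerivAt_id x).const_mul (-gam)
        simpa only [neg_mul, id, mul_one] using h2
      exact h1.exp
    · exact Eventually.of_forall fun x => mul_ne_zero (Real.exp_pos _).ne' (by linarith)
    · have := (h0.add hpow).const_sub lam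
      simpa using this
    · exact Real.tendsto_exp_atBot.comp hlin
    · have := ((hs.sub_const 1).mul hlim).div_const gam
      refine this.congr fun x => ?_
      have := hw x
      rw [Real.exp_neg]
      have := (Real.exp_pos (gam * x)).ne'
      field_simp
      ring
  have h2 := ((hs.const_mul lam).sub (key.div hlim hC.ne'))
  have e : lam * p - (p - 1) * C / gam / C = gam := by
    field_simp
    linarith
  rw [e] at h2
  refine h2.congr fun x => ?_
  have := hw x
  rw [Pi.div_apply, Real.exp_neg]
  have := (Real.exp_pos (gam * x)).ne'
  field_simp
  ring

lemma tw_a_tendsto {p lam p' lam' : ℝ} {v v' : ℝ → ℝ} (hv : IsTWProfile p lam v)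
    (hv' : IsTWProfile p' lam' v') {a b : ℝ → ℝ} (hab : Tendsto (fun t => a t + b t) atBot atTop)
    (h : ∀ t, v (a t) = v' (b t)) : Tendsto a atBot atTop := by
  obtain ⟨hm, hlt⟩ := tw_lt_one hv
  obtain ⟨hm', hlt'⟩ := tw_lt_one hv'
  rw [tendsto_atTop]
  intro M
  obtain ⟨B, hB⟩ := (hv'.2.2.2.2.2.2.eventually (lt_mem_nhds (hlt M))).exists
  filter_upwards [hab.eventually_ge_atTop (M + B)] with t ht
  by_contra hcon
  push Not at hcon
  have h1 : B < b t := by linarith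
  have h2 := hm hcon
  have h3 := hm' h1
  rw [h t] at h2
  linarith

theorem intersection_values_asymptotics
    (p lam lam' h h' gam gam' C C' d : ℝ)
    (hp : 1 < p) (hlam : 1 ≤ lam) (hlam' : 1 ≤ lam')
    (vl vl' : ℝ → ℝ)
    (hprof : IsTWProfile p lam vl) (hprof' : IsTWProfile p lam' vl')
    (hasym : HasExpAsym p lam gam C vl) (hasym' : HasExpAsym p lam' gam' C' vl')
    (hd : d = (gam * gam' + (p - 1)) / p)
    (X : ℝ → ℝ)
    (hX : ∀ τ, vl (X τ - lam * τ + h) = vl' (-(X τ) - lam' * τ + h')) :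
    ∃ K > 0,
      Tendsto (fun τ => Real.exp (-(d * τ)) * (1 - vl (X τ - lam * τ + h)))
        atBot (𝓝 K) ∧
      Tendsto (fun τ => Real.exp (-(d * τ)) * deriv vl (X τ - lam * τ + h))
        atBot (𝓝 (gam * K)) ∧
      Tendsto (fun τ => Real.exp (-(d * τ)) * deriv vl' (-(X τ) - lam' * τ + h'))
        atBot (𝓝 (gam' * K)) := by
  have hda := tw_deriv_asym hp hprof hasym
  have hda' := tw_deriv_asym hp hprof' hasym'
  obtain ⟨hm, hlt⟩ := tw_lt_one hprof
  obtain ⟨hm', hlt'⟩ := tw_lt_one hprof'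
  obtain ⟨hg, hC, hch, hl⟩ := hasym
  obtain ⟨hg', hC', hch', hl'⟩ := hasym'
  have hsum : Tendsto (fun τ => (X τ - lam * τ + h) + (-(X τ) - lam' * τ + h')) atBot atTop := by
    have h1 : Tendsto (fun τ : ℝ => (-(lam + lam')) * τ) atBot atTop :=
      tendsto_id.const_mul_atBot_of_neg (by linarith)
    refine (tendsto_atTop_add_const_right _ (h + h') h1).congr fun τ => ?_
    ring
  have ha : Tendsto (fun τ => X τ - lam * τ + h) atBot atTop :=
    tw_a_tendsto hprof hprof' hsum hX
  have hb : Tendsto (fun τ => -(X τ) - lam' * τ + h') atBot atTop :=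
    tw_a_tendsto hprof' hprof (by simpa only [add_comm] using hsum) fun τ => (hX τ).symm
  have hgg : gam + gam' ≠ 0 := by linarith
  have hdd : d * (gam + gam') = gam * gam' * (lam + lam') := by
    rw [hd]
    have hp0 : p ≠ 0 := by linarith
    field_simp
    linear_combination gam' * hch + gam * hch'
  have la := ((Real.continuousAt_log hC.ne').tendsto.comp (hl.comp ha)).const_mul gam'
  have lb := ((Real.continuousAt_log hC'.ne').tendsto.comp (hl'.comp hb)).const_mul gam
  have lc := (((la.add lb).sub_const (gam * gam' * (h + h'))).div_const (gam + gam'))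
  have hK := (Real.continuous_exp.tendsto _).comp lc
  set K := Real.exp ((gam' * Real.log C + gam * Real.log C' - gam * gam' * (h + h')) /
    (gam + gam')) with hKdef
  have hmain : Tendsto (fun τ => Real.exp (-(d * τ)) * (1 - vl (X τ - lam * τ + h)))
        atBot (𝓝 K) := by
    refine hK.congr fun τ => ?_
    have hw : 0 < 1 - vl (X τ - lam * τ + h) := sub_pos.2 (hlt _)
    simp only [Function.comp]
    rw [← hX τ, Real.log_mul (Real.exp_pos _).ne' hw.ne', Real.log_mul (Real.exp_pos _).ne' hw.ne',
      Real.log_exp, Real.log_exp]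
    conv_rhs => rw [← Real.exp_log hw, ← Real.exp_add]
    congr 1
    rw [div_eq_iff hgg]
    linear_combination τ * hdd
  refine ⟨K, Real.exp_pos _, hmain, ?_, ?_⟩
  · refine ((hda.comp ha).mul hmain).congr fun τ => ?_
    have hw : 1 - vl (X τ - lam * τ + h) ≠ 0 := (sub_pos.2 (hlt _)).ne'
    simp only [Function.comp]
    field_simp
  · refine ((hda'.comp hb).mul hmain).congr fun τ => ?_
    have hw : 1 - vl' (-(X τ) - lam' * τ + h') ≠ 0 := (sub_pos.2 (hlt' _)).ne'
    simp only [Function.comp]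
    rw [hX τ]
    field_simp
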